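/- For d ≥ 3 and z in the upper half-plane, the Stieltjes transform of the Kesten–McKay distribution satisfies m_d(z) = 1/(-z - (d/(d-1)) m_sc(z)), where m_sc is the Stieltjes transform of the semicircle distribution. -/

import Mathlib

open MeasureTheory

/-- The Kesten–McKay density
`ρ_d(x) = 1_{x∈[-2,2]} (1 + 1/(d-1) - x²/d)⁻¹ √(4-x²)/(2π)`. -/
noncomputable def kestenMcKayDensity (d : ℕ) (x : ℝ) : ℝ :=
  if x ∈ Set.Icc (-2 : ℝ) 2 then
    (1 + 1 / ((d : ℝ) - 1) - x ^ 2 / d)⁻¹ * Real.sqrt (4 - x ^ 2) / (2 * Real.pi)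
  else 0

/-- Factorisation of the quadratic on the unit circle. -/
lemma km_factor (q t : ℂ) :
    1 + 2 * q * Complex.cos t + q ^ 2
      = (1 + q * Complex.exp (t * Complex.I)) * (1 + q * Complex.exp (-t * Complex.I)) := by
  have h : Complex.exp (t * Complex.I) * Complex.exp (-t * Complex.I) = 1 := by
    rw [← Complex.exp_add]; simp
  rw [Complex.cos]
  linear_combination (-q ^ 2) * h

lemma km_norm_lt (q : ℂ) (hq : ‖q‖ < 1) (t : ℝ) :
    ‖-q * Complex.exp (t * Complex.I)‖ < 1 ∧ ‖-q * Complex.exp (-t * Complex.I)‖ < 1 := by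
  constructor
  · rw [norm_mul, norm_neg, Complex.norm_exp_ofReal_mul_I]; simpa using hq
  · have := Complex.norm_exp_ofReal_mul_I (-t)
    rw [Complex.ofReal_neg] at this
    rw [norm_mul, norm_neg, this]; simpa using hq

lemma km_one_sub_ne (w : ℂ) (hw : ‖w‖ < 1) : 1 - w ≠ 0 := by
  intro h
  have : w = 1 := by linear_combination -h
  rw [this] at hw
  simp at hw

lemma km_ne_zero (q : ℂ) (hq : ‖q‖ < 1) (t : ℝ) :
    1 + 2 * q * Complex.cos t + q ^ 2 ≠ 0 := by
  rw [km_factor]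
  obtain ⟨h1, h2⟩ := km_norm_lt q hq t
  have e1 := km_one_sub_ne _ h1
  have e2 := km_one_sub_ne _ h2
  apply mul_ne_zero
  · intro h; apply e1; linear_combination h
  · intro h; apply e2; linear_combination h

lemma km_hasSum (q : ℂ) (hq : ‖q‖ < 1) (t : ℝ) :
    HasSum (fun k : ℕ => (-q) ^ k * (Complex.sin ((k + 1 : ℕ) * t) * Complex.sin t))
      (Complex.sin t ^ 2 / (1 + 2 * q * Complex.cos t + q ^ 2)) := by
  obtain ⟨h1, h2⟩ := km_norm_lt q hq t
  have e1 := km_one_sub_ne _ h1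
  have e2 := km_one_sub_ne _ h2
  have s1 := hasSum_geometric_of_norm_lt_one h1
  have s2 := hasSum_geometric_of_norm_lt_one h2
  have s := ((s2.mul_left (Complex.exp (-t * Complex.I))).sub
    (s1.mul_left (Complex.exp (t * Complex.I)))).mul_right (Complex.I / 2 * Complex.sin t)
  refine cast (congrArg₂ (fun (f : ℕ → ℂ) a => HasSum f a) (funext ?_) ?_) s
  · intro k
    symm
    rw [mul_pow, mul_pow, ← Complex.exp_nat_mul, ← Complex.exp_nat_mul, Complex.sin]
    have a1 : Complex.exp (-(((k + 1 : ℕ) : ℂ) * t) * Complex.I)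
        = Complex.exp (-t * Complex.I) * Complex.exp (k * (-t * Complex.I)) := by
      rw [← Complex.exp_add]; congr 1; push_cast; ring
    have a2 : Complex.exp ((((k + 1 : ℕ) : ℂ) * t) * Complex.I)
        = Complex.exp (t * Complex.I) * Complex.exp (k * (t * Complex.I)) := by
      rw [← Complex.exp_add]; congr 1; push_cast; ring
    rw [a1, a2]
    ring
  · symm
    rw [km_factor]
    have h : Complex.exp (t * Complex.I) * Complex.exp (-t * Complex.I) = 1 := by
      rw [← Complex.exp_add]; simp
    have hs : Complex.sin t = (Complex.exp (-t * Complex.I) - Complex.exp (t * Complex.I))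
        * Complex.I / 2 := rfl
    have f1 : (1 + q * Complex.exp (t * Complex.I)) ≠ 0 := by
      intro h; apply e1; linear_combination h
    have f2 : (1 + q * Complex.exp (-t * Complex.I)) ≠ 0 := by
      intro h; apply e2; linear_combination h
    have g1 : (1 - -q * Complex.exp (t * Complex.I)) = (1 + q * Complex.exp (t * Complex.I)) := by
      ring
    have g2 : (1 - -q * Complex.exp (-t * Complex.I))
        = (1 + q * Complex.exp (-t * Complex.I)) := by ring
    rw [g1, g2, sq]
    nth_rewrite 1 [hs]
    generalize Complex.exp (t * Complex.I) = u at *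
    generalize Complex.exp (-t * Complex.I) = v at *
    obtain ⟨A, hA⟩ : ∃ A, A = 1 + q * u := ⟨_, rfl⟩
    obtain ⟨B, hB⟩ : ∃ B, B = 1 + q * v := ⟨_, rfl⟩
    rw [← hA] at f1 ⊢
    rw [← hB] at f2 ⊢
    field_simp
    rw [hA, hB]
    ring

lemma km_cos_int (n : ℕ) :
    ∫ t in (0:ℝ)..Real.pi, Complex.cos ((n : ℂ) * t) = if n = 0 then (Real.pi : ℂ) else 0 := by
  split_ifs with h
  · subst h; simp
  · have hn : (n : ℂ) ≠ 0 := by exact_mod_cast h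
    rw [integral_cos_mul_complex hn]
    have : Complex.sin ((n : ℂ) * Real.pi) = 0 := by
      exact_mod_cast congrArg (fun x : ℝ => (x : ℂ)) (Real.sin_nat_mul_pi n)
    simp [this]

lemma km_orth (k : ℕ) :
    ∫ t in (0:ℝ)..Real.pi, Complex.sin ((k + 1 : ℕ) * t) * Complex.sin t
      = if k = 0 then (Real.pi : ℂ) / 2 else 0 := by
  have h : ∀ t : ℝ, Complex.sin ((k + 1 : ℕ) * t) * Complex.sin t
      = (1 / 2 : ℂ) * (Complex.cos ((k : ℂ) * t) - Complex.cos (((k + 2 : ℕ) : ℂ) * t)) := by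
    intro t
    have a1 : (k : ℂ) * t = (k + 1 : ℕ) * t - t := by push_cast; ring
    have a2 : ((k + 2 : ℕ) : ℂ) * t = (k + 1 : ℕ) * t + t := by push_cast; ring
    rw [a1, a2, Complex.cos_sub, Complex.cos_add]
    ring
  simp_rw [h]
  rw [intervalIntegral.integral_const_mul, intervalIntegral.integral_sub, km_cos_int, km_cos_int]
  · split_ifs <;> simp_all <;> ring
  · exact Continuous.intervalIntegrable (by fun_prop) _ _
  · exact Continuous.intervalIntegrable (by fun_prop) _ _

lemma km_cont (q : ℂ) (hq : ‖q‖ < 1) :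
    Continuous (fun t : ℝ => Complex.sin t ^ 2 / (1 + 2 * q * Complex.cos t + q ^ 2)) :=
  Continuous.div (by fun_prop) (by fun_prop) (km_ne_zero q hq)

lemma km_integral (q : ℂ) (hq : ‖q‖ < 1) :
    ∫ t in (0:ℝ)..Real.pi, Complex.sin t ^ 2 / (1 + 2 * q * Complex.cos t + q ^ 2)
      = (Real.pi : ℂ) / 2 := by
  have key := intervalIntegral.hasSum_integral_of_dominated_convergence
    (μ := volume) (a := 0) (b := Real.pi)
    (F := fun (k : ℕ) (t : ℝ) =>
      (-q) ^ k * (Complex.sin ((k + 1 : ℕ) * t) * Complex.sin t))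
    (f := fun t : ℝ => Complex.sin t ^ 2 / (1 + 2 * q * Complex.cos t + q ^ 2))
    (fun k _ => ‖q‖ ^ k)
    (fun k => Continuous.aestronglyMeasurable (by fun_prop))
    (fun k => Filter.Eventually.of_forall fun t _ => by
      have h1 : ‖Complex.sin ((k + 1 : ℕ) * t)‖ ≤ 1 := by
        have : Complex.sin ((k + 1 : ℕ) * t) = ((Real.sin ((k + 1 : ℕ) * t) : ℝ) : ℂ) := by
          push_cast; rfl
        rw [this, Complex.norm_real]; exact Real.abs_sin_le_one _
      have h2 : ‖Complex.sin t‖ ≤ 1 := by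
        rw [← Complex.ofReal_sin, Complex.norm_real]; exact Real.abs_sin_le_one _
      rw [norm_mul, norm_mul, norm_pow, norm_neg]
      exact mul_le_of_le_one_right (by positivity) (mul_le_one₀ h1 (norm_nonneg _) h2))
    (Filter.Eventually.of_forall fun t _ =>
      summable_geometric_of_lt_one (norm_nonneg _) hq)
    (by simp)
    (Filter.Eventually.of_forall fun t _ => km_hasSum q hq t)
  simp_rw [intervalIntegral.integral_const_mul, km_orth] at key
  refine key.unique ?_
  have h0 := hasSum_single (f := fun k : ℕ =>
    (-q) ^ k * (if k = 0 then (Real.pi : ℂ) / 2 else 0)) 0 (fun k hk => by simp [hk])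
  simpa using h0

lemma km_partial (q b c : ℂ) (hX : 1 + 2 * q * c + q ^ 2 ≠ 0) (hY : 1 + 2 * b * c + b ^ 2 ≠ 0)
    (hZ : 1 + 2 * (-b) * c + (-b) ^ 2 ≠ 0) (hb : 1 + b ^ 2 ≠ 0) (s : ℂ) :
    (q ^ 2 - b ^ 2) * (1 - b ^ 2 * q ^ 2) *
      (s / ((1 + 2 * q * c + q ^ 2) * ((1 + b ^ 2) ^ 2 - 4 * b ^ 2 * c ^ 2)))
    = q ^ 2 * (s / (1 + 2 * q * c + q ^ 2))
      + -(b * (q + b) * (1 + b * q)) / (2 * (1 + b ^ 2)) * (s / (1 + 2 * b * c + b ^ 2))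
      + (b * (q - b) * (1 - b * q)) / (2 * (1 + b ^ 2)) * (s / (1 + 2 * (-b) * c + (-b) ^ 2)) := by
  have hf : (1 + b ^ 2) ^ 2 - 4 * b ^ 2 * c ^ 2
      = (1 + 2 * b * c + b ^ 2) * (1 + 2 * (-b) * c + (-b) ^ 2) := by ring
  have hZ' : (1 + 2 * (-b) * c + (-b) ^ 2) = 1 + b ^ 2 - 2 * b * c := by ring
  rw [hf]
  rw [hZ'] at hZ ⊢
  obtain ⟨X, hXe⟩ : ∃ X, X = 1 + 2 * q * c + q ^ 2 := ⟨_, rfl⟩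
  obtain ⟨Y, hYe⟩ : ∃ Y, Y = 1 + 2 * b * c + b ^ 2 := ⟨_, rfl⟩
  obtain ⟨Z, hZe⟩ : ∃ Z, Z = 1 + b ^ 2 - 2 * b * c := ⟨_, rfl⟩
  obtain ⟨W, hWe⟩ : ∃ W, W = 1 + b ^ 2 := ⟨_, rfl⟩
  rw [← hXe] at hX ⊢
  rw [← hYe] at hY ⊢
  rw [← hZe] at hZ ⊢
  rw [← hWe] at hb ⊢
  field_simp
  rw [hXe, hYe, hZe, hWe]
  ring

lemma km_full (q b : ℂ) (hq : ‖q‖ < 1) (hb : ‖b‖ < 1) (hqb : q ^ 2 - b ^ 2 ≠ 0)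
    (hbb : 1 + b ^ 2 ≠ 0) (hbq : 1 - b ^ 2 * q ^ 2 ≠ 0) :
    ∫ t in (0:ℝ)..Real.pi, Complex.sin t ^ 2 /
      ((1 + 2 * q * Complex.cos t + q ^ 2) * ((1 + b ^ 2) ^ 2 - 4 * b ^ 2 * Complex.cos t ^ 2))
      = (Real.pi : ℂ) / 2 / ((1 + b ^ 2) * (1 - b ^ 2 * q ^ 2)) := by
  have hb' : ‖-b‖ < 1 := by rwa [norm_neg]
  apply mul_left_cancel₀ (mul_ne_zero hqb hbq)
  rw [← intervalIntegral.integral_const_mul]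
  simp_rw [fun t : ℝ => km_partial q b (Complex.cos t) (km_ne_zero q hq t) (km_ne_zero b hb t)
    (km_ne_zero (-b) hb' t) hbb (Complex.sin t ^ 2)]
  have i1 := (km_cont q hq).const_mul (q ^ 2)
  have i2 := (km_cont b hb).const_mul (-(b * (q + b) * (1 + b * q)) / (2 * (1 + b ^ 2)))
  have i3 := (km_cont (-b) hb').const_mul ((b * (q - b) * (1 - b * q)) / (2 * (1 + b ^ 2)))
  rw [intervalIntegral.integral_add (by exact (i1.add i2).intervalIntegrable _ _)
      (i3.intervalIntegrable _ _),
    intervalIntegral.integral_add (i1.intervalIntegrable _ _) (i2.intervalIntegrable _ _),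
    intervalIntegral.integral_const_mul, intervalIntegral.integral_const_mul,
    intervalIntegral.integral_const_mul, km_integral q hq, km_integral b hb, km_integral (-b) hb']
  have hR : (q ^ 2 - b ^ 2) * (1 - b ^ 2 * q ^ 2) *
      ((Real.pi : ℂ) / 2 / ((1 + b ^ 2) * (1 - b ^ 2 * q ^ 2)))
      = (q ^ 2 - b ^ 2) * (Real.pi : ℂ) / (2 * (1 + b ^ 2)) := by
    generalize 1 - b ^ 2 * q ^ 2 = V at *
    field_simp
  rw [hR]
  field_simp
  ring

lemma km_subst (g : ℝ → ℂ) (hg : ContinuousOn g (Set.Icc (-2) 2)) :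
    ∫ x in (-2:ℝ)..2, g x = ∫ t in (0:ℝ)..Real.pi, (2 * Real.sin t : ℝ) • g (2 * Real.cos t) := by
  have h := intervalIntegral.integral_comp_smul_deriv' (a := 0) (b := Real.pi)
    (f := fun t => 2 * Real.cos t) (f' := fun t => -(2 * Real.sin t)) (g := g)
    (fun t _ => by simpa using (Real.hasDerivAt_cos t).const_mul 2)
    (by fun_prop)
    (hg.mono (by
      rintro _ ⟨t, _, rfl⟩
      constructor <;> dsimp only <;> linarith [Real.neg_one_le_cos t, Real.cos_le_one t]))
  simp only [Real.cos_zero, Real.cos_pi, mul_one, mul_neg, Function.comp, neg_smul,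
    intervalIntegral.integral_neg] at h
  rw [intervalIntegral.integral_symm, ← h, neg_neg]

/-- For `d ≥ 3` and `z` in the upper half-plane, the Stieltjes transform of the
Kesten–McKay distribution satisfies `m_d(z) = 1/(-z - (d/(d-1)) m_sc(z))`, where
`m_sc` is the Stieltjes transform of the semicircle distribution, characterized
by `m_sc² + z m_sc + 1 = 0` and `Im m_sc > 0`. -/
theorem kestenMcKay_stieltjes_formula (d : ℕ) (hd : 3 ≤ d) (z : ℂ) (hz : 0 < z.im)
    (msc : ℂ) (hmsc : msc ^ 2 + z * msc + 1 = 0) (hmscIm : 0 < msc.im) :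
    ∫ x : ℝ, (kestenMcKayDensity d x : ℂ) / ((x : ℂ) - z)
      = 1 / (-z - ((d : ℂ) / ((d : ℂ) - 1)) * msc) := by
  have hd' : (3 : ℝ) ≤ d := by exact_mod_cast hd
  have hq0 : msc ≠ 0 := by rintro rfl; simp at hmscIm
  have hzq : z = -(msc + msc⁻¹) := by
    field_simp
    linear_combination hmsc
  have hqn : ‖msc‖ < 1 := by
    have h1 : z.im = -msc.im + msc.im / Complex.normSq msc := by
      rw [hzq]; simp [Complex.inv_im]; ring
    have hN : 0 < Complex.normSq msc := Complex.normSq_pos.2 hq0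
    have h2 : msc.im < msc.im / Complex.normSq msc := by linarith
    rw [lt_div_iff₀ hN] at h2
    have h3 : Complex.normSq msc < 1 := by nlinarith
    rw [Complex.normSq_eq_norm_sq] at h3
    nlinarith [norm_nonneg msc]
  obtain ⟨b, hb⟩ : ∃ b : ℝ, b = Real.sqrt (1 / ((d : ℝ) - 1)) := ⟨_, rfl⟩
  have hb2 : b ^ 2 = 1 / ((d : ℝ) - 1) := by
    rw [hb, Real.sq_sqrt]; apply div_nonneg <;> linarith
  have hb0 : 0 ≤ b := by rw [hb]; positivity
  have hb2l : b ^ 2 ≤ 1 / 2 := by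
    rw [hb2]; apply one_div_le_one_div_of_le <;> linarith
  have hb2p : 0 < b ^ 2 := by
    rw [hb2]; apply one_div_pos.2; linarith
  have hb1 : b < 1 := by nlinarith
  have hbn : ‖(b : ℂ)‖ < 1 := by
    rw [Complex.norm_real, Real.norm_eq_abs, abs_of_nonneg hb0]; exact hb1
  have hdb : (d : ℝ) = (1 + b ^ 2) / b ^ 2 := by
    rw [hb2]
    have : (d : ℝ) - 1 ≠ 0 := by linarith
    field_simp; ring
  have hdbC : (d : ℂ) = (1 + (b:ℂ) ^ 2) / (b:ℂ) ^ 2 := by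
    exact_mod_cast congrArg (fun x : ℝ => (x : ℂ)) hdb
  have hbC : (b : ℂ) ≠ 0 := by
    have : b ≠ 0 := by rintro rfl; simp at hb2p
    exact_mod_cast this
  have hbb : (1 : ℂ) + (b:ℂ) ^ 2 ≠ 0 := by
    have : (1 : ℝ) + b ^ 2 ≠ 0 := by positivity
    exact_mod_cast this
  have hqb : msc ^ 2 - (b:ℂ) ^ 2 ≠ 0 := by
    intro h
    have h' : (msc - b) * (msc + b) = 0 := by linear_combination h
    rcases mul_eq_zero.1 h' with h | h
    · have := congrArg Complex.im h
      simp at this; linarith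
    · have := congrArg Complex.im h
      simp at this; linarith
  have hbq : 1 - (b:ℂ) ^ 2 * msc ^ 2 ≠ 0 := by
    apply km_one_sub_ne
    rw [norm_mul, norm_pow, norm_pow]
    exact mul_lt_one_of_nonneg_of_lt_one_left (by positivity)
      (pow_lt_one₀ (norm_nonneg _) hbn two_ne_zero)
      (pow_le_one₀ (norm_nonneg _) hqn.le)
  -- the density on the interval
  have hden : ∀ x ∈ Set.Icc (-2 : ℝ) 2, 1 + 1 / ((d : ℝ) - 1) - x ^ 2 / d
      = ((1 + b ^ 2) ^ 2 - b ^ 2 * x ^ 2) / (1 + b ^ 2) := by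
    intro x _
    rw [← hb2, hdb]
    field_simp
  have hpos : ∀ x ∈ Set.Icc (-2 : ℝ) 2, 0 < (1 + b ^ 2) ^ 2 - b ^ 2 * x ^ 2 := by
    intro x hx
    have : x ^ 2 ≤ 4 := by nlinarith [hx.1, hx.2]
    nlinarith [mul_le_mul_of_nonneg_left this hb2p.le]
  have hxz : ∀ x : ℝ, (x : ℂ) - z ≠ 0 := by
    intro x h
    have := congrArg Complex.im h
    simp at this; linarith
  let g : ℝ → ℂ := fun x =>
    (((1 + b ^ 2) / ((1 + b ^ 2) ^ 2 - b ^ 2 * x ^ 2) * Real.sqrt (4 - x ^ 2)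
      / (2 * Real.pi) : ℝ) : ℂ) / ((x : ℂ) - z)
  have hgc : ContinuousOn g (Set.Icc (-2) 2) := by
    apply ContinuousOn.div
    · apply Complex.continuous_ofReal.comp_continuousOn
      apply ContinuousOn.div_const
      apply ContinuousOn.mul
      · exact ContinuousOn.div (by fun_prop) (by fun_prop) (fun x hx => (hpos x hx).ne')
      · fun_prop
    · fun_prop
    · intro x _; exact hxz x
  have e1 : ∫ x : ℝ, (kestenMcKayDensity d x : ℂ) / ((x : ℂ) - z)
      = ∫ x in (-2:ℝ)..2, g x := by
    rw [intervalIntegral.integral_of_le (by norm_num), ← integral_Icc_eq_integral_Ioc,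
      ← integral_indicator measurableSet_Icc]
    congr 1
    funext x
    by_cases hx : x ∈ Set.Icc (-2 : ℝ) 2
    · rw [Set.indicator_of_mem hx, kestenMcKayDensity, if_pos hx, hden x hx, inv_div]
    · rw [Set.indicator_of_notMem hx, kestenMcKayDensity, if_neg hx]; simp
  have e2 : ∫ t in (0:ℝ)..Real.pi, (2 * Real.sin t : ℝ) • g (2 * Real.cos t)
      = ∫ t in (0:ℝ)..Real.pi, (2 * (1 + (b:ℂ) ^ 2) * msc / Real.pi) * (Complex.sin t ^ 2 /
      ((1 + 2 * msc * Complex.cos t + msc ^ 2) *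
        ((1 + (b:ℂ) ^ 2) ^ 2 - 4 * (b:ℂ) ^ 2 * Complex.cos t ^ 2))) := by
    apply intervalIntegral.integral_congr
    intro t ht
    rw [Set.uIcc_of_le Real.pi_pos.le] at ht
    have hs := Real.sin_nonneg_of_mem_Icc ht
    have hsq : Real.sqrt (4 - (2 * Real.cos t) ^ 2) = 2 * Real.sin t := by
      have : 4 - (2 * Real.cos t) ^ 2 = (2 * Real.sin t) ^ 2 := by
        linarith [Real.sin_sq_add_cos_sq t, mul_pow 2 (Real.cos t) 2, mul_pow 2 (Real.sin t) 2]
      rw [this, Real.sqrt_sq (by linarith)]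
    have hX := km_ne_zero msc hqn t
    have hY : ((1 + (b:ℂ) ^ 2) ^ 2 - 4 * (b:ℂ) ^ 2 * Complex.cos t ^ 2) ≠ 0 := by
      have := (hpos (2 * Real.cos t) (by
        constructor <;> linarith [Real.neg_one_le_cos t, Real.cos_le_one t])).ne'
      rw [← Complex.ofReal_cos]
      intro h
      apply this
      have h' : (1 + b ^ 2) ^ 2 - 4 * b ^ 2 * Real.cos t ^ 2 = 0 := by exact_mod_cast h
      linarith
    have hW : (2 * Complex.cos t - z) = (1 + 2 * msc * Complex.cos t + msc ^ 2) / msc := by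
      rw [hzq]; field_simp; ring
    have hpi : (Real.pi : ℂ) ≠ 0 := by exact_mod_cast Real.pi_ne_zero
    have hY' : (1 + (b:ℂ) ^ 2) ^ 2 - (b:ℂ) ^ 2 * (2 * Complex.cos t) ^ 2
        = (1 + (b:ℂ) ^ 2) ^ 2 - 4 * (b:ℂ) ^ 2 * Complex.cos t ^ 2 := by ring
    simp only [g]
    rw [hsq, Complex.real_smul]
    push_cast
    rw [hW, hY']
    generalize (1 + 2 * msc * Complex.cos t + msc ^ 2) = X at *
    generalize ((1 + (b:ℂ) ^ 2) ^ 2 - 4 * (b:ℂ) ^ 2 * Complex.cos t ^ 2) = Y at *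
    field_simp
  rw [e1, km_subst g hgc, e2, intervalIntegral.integral_const_mul,
    km_full msc b hqn hbn hqb hbb hbq]
  have hpi : (Real.pi : ℂ) ≠ 0 := by exact_mod_cast Real.pi_ne_zero
  have hd1 : (d : ℂ) / ((d : ℂ) - 1) = 1 + (b:ℂ) ^ 2 := by
    have : (d : ℂ) - 1 = 1 / (b:ℂ) ^ 2 := by rw [hdbC]; field_simp; ring
    rw [this, hdbC]; field_simp
  have hfin : -z - (1 + (b:ℂ) ^ 2) * msc = (1 - (b:ℂ) ^ 2 * msc ^ 2) / msc := by
    rw [hzq]; field_simp; ring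
  rw [hd1, hfin]
  field_simp
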